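/- arXiv:2112.05250 — 2 statements merged into one kernel-verified Lean document; each statement's English description precedes it below -/
import Mathlib

section
/- Let E be a finite-dimensional real inner product space and let g, h : E → ℝ be convex with Fenchel conjugates g*, h* : E → ℝ ∪ {+∞}. Suppose x̄ ∈ E is a global minimizer of g − h, and ȳ ∈ E is a common subgradient, ȳ ∈ ∂g(x̄) ∩ ∂h(x̄). Then g*(ȳ) and h*(ȳ) are finite, h*(ȳ) − g*(ȳ) = g(x̄) − h(x̄), and h*(y) − g*(y) ≥ h*(ȳ) − g*(ȳ) for every y with h*(y) < +∞ (so ȳ solves the dual problem of minimizing h* − g* over dom h*). -/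
open RealInnerProductSpace

/-- The Fenchel conjugate of a real-valued function, with values in `EReal`. -/
noncomputable def fenchelConj {E : Type*} [NormedAddCommGroup E] [InnerProductSpace ℝ E]
    (f : E → ℝ) (y : E) : EReal :=
  ⨆ x : E, ((⟪y, x⟫ - f x : ℝ) : EReal)

section FenchelConj

variable {E : Type*} [NormedAddCommGroup E] [InnerProductSpace ℝ E]

theorem le_fenchelConj (f : E → ℝ) (y x : E) :
    ((⟪y, x⟫ - f x : ℝ) : EReal) ≤ fenchelConj f y :=
  le_iSup (fun x : E => ((⟪y, x⟫ - f x : ℝ) : EReal)) x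

theorem fenchelConj_le_coe {f : E → ℝ} {y : E} {a : ℝ} (ha : ∀ x, ⟪y, x⟫ - f x ≤ a) :
    fenchelConj f y ≤ a :=
  iSup_le fun x => EReal.coe_le_coe_iff.2 (ha x)

/-- Equality in the Fenchel–Young inequality at a subgradient. -/
theorem fenchelConj_eq_of_subgradient {f : E → ℝ} {x y : E}
    (hy : ∀ q, f x + ⟪y, q - x⟫ ≤ f q) :
    fenchelConj f y = ((⟪y, x⟫ - f x : ℝ) : EReal) := by
  refine le_antisymm (fenchelConj_le_coe fun q => ?_) (le_fenchelConj f y x)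
  have hq := hy q
  rw [inner_sub_right] at hq
  linarith

theorem exists_fenchelConj_eq_coe {f : E → ℝ} {y : E} (hy : fenchelConj f y < ⊤) :
    ∃ a : ℝ, fenchelConj f y = a :=
  ⟨_, (EReal.coe_toReal hy.ne
    ((EReal.bot_lt_coe _).trans_le (le_fenchelConj f y 0)).ne').symm⟩

/-- If `c ≤ g - h` everywhere, then `c ≤ h* - g*` on the domain of `h*`. -/
theorem coe_le_fenchelConj_sub_fenchelConj {g h : E → ℝ} {c : ℝ} (hc : ∀ x, c ≤ g x - h x)
    {y : E} (hy : fenchelConj h y < ⊤) :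
    (c : EReal) ≤ fenchelConj h y - fenchelConj g y := by
  obtain ⟨a, ha⟩ := exists_fenchelConj_eq_coe hy
  have hle : fenchelConj g y ≤ ((a - c : ℝ) : EReal) := fenchelConj_le_coe fun x => by
    have hx := le_fenchelConj h y x
    rw [ha, EReal.coe_le_coe_iff] at hx
    linarith [hc x]
  obtain ⟨b, hb⟩ := exists_fenchelConj_eq_coe (hle.trans_lt (EReal.coe_lt_top _))
  rw [hb, EReal.coe_le_coe_iff] at hle
  rw [ha, hb, ← EReal.coe_sub, EReal.coe_le_coe_iff]
  linarith

end FenchelConj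

/-- If `x̄` is a global minimizer of `g - h` and `ȳ ∈ ∂g(x̄) ∩ ∂h(x̄)`, then
`g*(ȳ)` and `h*(ȳ)` are finite, `h*(ȳ) - g*(ȳ) = g(x̄) - h(x̄)`, and `ȳ` solves
the dual problem of minimizing `h* - g*` over `dom h*`. -/
theorem primal_solution_gives_dual_solution
    {E : Type*} [NormedAddCommGroup E] [InnerProductSpace ℝ E] [FiniteDimensional ℝ E]
    (g h : E → ℝ) (hg : ConvexOn ℝ Set.univ g) (hh : ConvexOn ℝ Set.univ h)
    (xbar ybar : E)
    (hmin : ∀ x : E, g xbar - h xbar ≤ g x - h x)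
    (hsubg : ∀ q : E, g xbar + ⟪ybar, q - xbar⟫ ≤ g q)
    (hsubh : ∀ q : E, h xbar + ⟪ybar, q - xbar⟫ ≤ h q) :
    fenchelConj g ybar < ⊤ ∧ fenchelConj h ybar < ⊤ ∧
    fenchelConj h ybar - fenchelConj g ybar = ((g xbar - h xbar : ℝ) : EReal) ∧
    ∀ y : E, fenchelConj h y < ⊤ →
      fenchelConj h ybar - fenchelConj g ybar ≤ fenchelConj h y - fenchelConj g y := by
  have hgy := fenchelConj_eq_of_subgradient hsubg
  have hhy := fenchelConj_eq_of_subgradient hsubh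
  have hval : fenchelConj h ybar - fenchelConj g ybar = ((g xbar - h xbar : ℝ) : EReal) := by
    rw [hgy, hhy, ← EReal.coe_sub, sub_sub_sub_cancel_left]
  refine ⟨hgy ▸ EReal.coe_lt_top _, hhy ▸ EReal.coe_lt_top _, hval, fun y hy => ?_⟩
  rw [hval]
  exact coe_le_fenchelConj_sub_fenchelConj hmin hy
end

section
/- Let E be a real inner product space, g, h : E → ℝ functions with Fenchel conjugates g*, h* : E → ℝ ∪ {+∞}, f = g − h, and assume f_inf := inf_{x∈E} f(x) > −∞. Let (x_k), (X_k) be DCA sequences: X_k ∈ ∂h(x_k) and x_{k+1} a global minimizer of p ↦ g(p) − ⟪X_k, p − x_k⟫ for every k. Then g*(X_k) and h*(X_k) are finite for all k, the real sequence (g(x_k) − h(x_k)) is nonincreasing, and both sequences (g(x_k) − h(x_k)) and (h*(X_k) − g*(X_k)) converge to a common limit f̄ ∈ ℝ with f̄ ≥ f_inf. -/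
open Filter RealInnerProductSpace

/-- The Fenchel conjugate at `y` is attained at a maximizer of `p ↦ ⟪y, p⟫ - f p`. -/
theorem fenchelConj_eq_of_forall_le {E : Type*} [NormedAddCommGroup E] [InnerProductSpace ℝ E]
    {f : E → ℝ} {y a : E} (ha : ∀ p, ⟪y, p⟫ - f p ≤ ⟪y, a⟫ - f a) :
    fenchelConj f y = ((⟪y, a⟫ - f a : ℝ) : EReal) :=
  le_antisymm (iSup_le fun p => EReal.coe_le_coe_iff.2 (ha p))
    (le_iSup (fun p => ((⟪y, p⟫ - f p : ℝ) : EReal)) a)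

/-- Asymptotic primal-dual convergence of the DCA: if `f = g - h` is bounded
below and `(x_k), (X_k)` are DCA sequences, then `g*(X_k)` and `h*(X_k)` are
finite, the primal values `g(x_k) - h(x_k)` are nonincreasing, and both the
primal values and the dual values `h*(X_k) - g*(X_k)` converge to a common
limit `f̄ ≥ f_inf`. -/
theorem dca_primal_dual_values_converge
    {E : Type*} [NormedAddCommGroup E] [InnerProductSpace ℝ E]
    (g h : E → ℝ)
    (hbdd : BddBelow (Set.range fun p => g p - h p))
    (x X : ℕ → E)
    (hXk : ∀ k : ℕ, ∀ q : E, h (x k) + ⟪X k, q - x k⟫ ≤ h q)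
    (hxk : ∀ k : ℕ, ∀ p : E,
      g (x (k+1)) - ⟪X k, x (k+1) - x k⟫ ≤ g p - ⟪X k, p - x k⟫) :
    (∀ k : ℕ, fenchelConj g (X k) < ⊤ ∧ fenchelConj h (X k) < ⊤) ∧
    (∀ k : ℕ, g (x (k+1)) - h (x (k+1)) ≤ g (x k) - h (x k)) ∧
    ∃ fbar : ℝ,
      Tendsto (fun k : ℕ => g (x k) - h (x k)) atTop (nhds fbar) ∧
      Tendsto (fun k : ℕ => fenchelConj h (X k) - fenchelConj g (X k)) atTop
        (nhds ((fbar : ℝ) : EReal)) ∧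
      sInf (Set.range fun p => g p - h p) ≤ fbar := by
  have conj_g (k : ℕ) :
      fenchelConj g (X k) = ((⟪X k, x (k+1)⟫ - g (x (k+1)) : ℝ) : EReal) := by
    refine fenchelConj_eq_of_forall_le fun p => ?_
    have := hxk k p
    simp only [inner_sub_right] at this
    linarith
  have conj_h (k : ℕ) : fenchelConj h (X k) = ((⟪X k, x k⟫ - h (x k) : ℝ) : EReal) := by
    refine fenchelConj_eq_of_forall_le fun p => ?_
    have := hXk k p
    simp only [inner_sub_right] at this
    linarith
  have primal_le_dual (k : ℕ) : g (x (k+1)) - h (x (k+1)) ≤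
      (⟪X k, x k⟫ - h (x k)) - (⟪X k, x (k+1)⟫ - g (x (k+1))) := by
    have := hXk k (x (k+1))
    simp only [inner_sub_right] at this
    linarith
  have dual_le_primal (k : ℕ) :
      (⟪X k, x k⟫ - h (x k)) - (⟪X k, x (k+1)⟫ - g (x (k+1))) ≤ g (x k) - h (x k) := by
    have := hxk k (x k)
    simp only [inner_sub_right] at this
    linarith
  have primal_succ_le (k : ℕ) : g (x (k+1)) - h (x (k+1)) ≤ g (x k) - h (x k) :=
    (primal_le_dual k).trans (dual_le_primal k)
  have primal_tendsto : Tendsto (fun k => g (x k) - h (x k)) atTop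
      (nhds (⨅ k, (g (x k) - h (x k)))) :=
    tendsto_atTop_ciInf (antitone_nat_of_succ_le primal_succ_le)
      (hbdd.mono (Set.range_comp_subset_range x fun p => g p - h p))
  refine ⟨fun k => ?_, primal_succ_le, _, primal_tendsto, ?_, ?_⟩
  · rw [conj_g, conj_h]
    exact ⟨EReal.coe_lt_top _, EReal.coe_lt_top _⟩
  · simp only [conj_g, conj_h, ← EReal.coe_sub]
    exact EReal.tendsto_coe.2 (tendsto_of_tendsto_of_tendsto_of_le_of_le
      ((tendsto_add_atTop_iff_nat 1).2 primal_tendsto) primal_tendsto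
      primal_le_dual dual_le_primal)
  · exact le_ciInf fun k => csInf_le hbdd ⟨x k, rfl⟩
end
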